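/- Let k ≥ 2, let θ ∈ S^{k-1}, and let f : [−1, 1] → [0, ∞) be measurable with 0 < ∫_{S^{k-1}} f(⟨x, θ⟩) dσ_{k-1}(x) < ∞; let P_{θ;f} be the probability measure on S^{k-1} with density x ↦ c_{k,f} f(⟨x, θ⟩) with respect to σ_{k-1}. Then, under P_{θ;f}, the random variables x ↦ ⟨x, θ⟩ (with values in [−1, 1]) and x ↦ S_θ(x) (with values in ℝ^k, where S_θ(±θ) := 0) are stochastically independent. -/

import Mathlib

open MeasureTheory
open scoped RealInnerProductSpace Classical

/-- Spherical sign of `x` relative to `θ`, set to `0` at `x = ±θ`. -/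
noncomputable def sSign {k : ℕ} (θ x : EuclideanSpace ℝ (Fin k)) :
    EuclideanSpace ℝ (Fin k) :=
  if x = θ ∨ x = -θ then 0 else ‖x - ⟪x, θ⟫ • θ‖⁻¹ • (x - ⟪x, θ⟫ • θ)

/-- The surface area measure on the unit sphere `S^{k-1} ⊆ ℝ^k`: the
`(k−1)`-dimensional Hausdorff measure restricted to the sphere. -/
noncomputable def sphereMeasure (k : ℕ) : Measure (EuclideanSpace ℝ (Fin k)) :=
  (Measure.hausdorffMeasure ((k : ℝ) - 1)).restrict
    (Metric.sphere (0 : EuclideanSpace ℝ (Fin k)) 1)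

section InvariantMeasures

variable {E : Type*} [NormedAddCommGroup E] [InnerProductSpace ℝ E]

lemma exists_linearIsometryEquiv_fixing_map_eq {θ p q : E} (hp : ⟪p, θ⟫ = 0)
    (hq : ⟪q, θ⟫ = 0) (hpq : ‖p‖ = ‖q‖) : ∃ g : E ≃ₗᵢ[ℝ] E, g θ = θ ∧ g p = q := by
  refine ⟨(ℝ ∙ (p - q))ᗮ.reflection, ?_, Submodule.reflection_sub hpq⟩
  refine Submodule.reflection_mem_subspace_eq_self ?_
  rw [Submodule.mem_orthogonal_singleton_iff_inner_right, inner_sub_left, hp, hq, sub_zero]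

lemma inner_orthogonal_part {θ x : E} (hx : ⟪x, θ⟫ = 0) (y : E) :
    ⟪x, y - ⟪y, θ⟫ • θ⟫ = ⟪x, y⟫ := by
  rw [inner_sub_right, inner_smul_right, hx, mul_zero, sub_zero]

lemma inner_orthogonal_part_self {θ : E} (hθ : ‖θ‖ = 1) (x : E) :
    ⟪x - ⟪x, θ⟫ • θ, θ⟫ = 0 := by
  rw [inner_sub_left, real_inner_smul_left, real_inner_self_eq_norm_sq, hθ]
  ring

variable [MeasurableSpace E] [BorelSpace E]

lemma charFun_map_linearIsometryEquiv_eq {ν : Measure E} {g : E ≃ₗᵢ[ℝ] E}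
    (hg : MeasurePreserving g ν ν) (p : E) : charFun ν (g p) = charFun ν p := by
  rw [charFun_apply, charFun_apply,
    ← hg.integral_comp g.toHomeomorph.measurableEmbedding]
  simp

variable [CompleteSpace E] [SecondCountableTopology E]

/-- The finite measures on the unit sphere of the hyperplane `θᗮ` that are invariant under the
isometries fixing `θ` are proportional to each other. -/
lemma measure_univ_smul_eq_of_invariant {θ : E} (hθ : ‖θ‖ = 1) {ν₁ ν₂ : Measure E}
    [IsFiniteMeasure ν₁] [IsFiniteMeasure ν₂]
    (hs₁ : ∀ᵐ x ∂ν₁, ‖x‖ = 1 ∧ ⟪x, θ⟫ = 0) (hs₂ : ∀ᵐ x ∂ν₂, ‖x‖ = 1 ∧ ⟪x, θ⟫ = 0)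
    (hi₁ : ∀ g : E ≃ₗᵢ[ℝ] E, g θ = θ → MeasurePreserving g ν₁ ν₁)
    (hi₂ : ∀ g : E ≃ₗᵢ[ℝ] E, g θ = θ → MeasurePreserving g ν₂ ν₂) :
    ν₂ Set.univ • ν₁ = ν₁ Set.univ • ν₂ := by
  have := ν₁.smul_finite (measure_ne_top ν₂ Set.univ)
  have := ν₂.smul_finite (measure_ne_top ν₁ Set.univ)
  refine Measure.ext_of_charFun (funext fun y => ?_)
  set p := y - ⟪y, θ⟫ • θ with hp
  have integral_charFun {ν ν' : Measure E} (hs : ∀ᵐ x ∂ν, ‖x‖ = 1 ∧ ⟪x, θ⟫ = 0)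
      (hs' : ∀ᵐ x ∂ν', ‖x‖ = 1 ∧ ⟪x, θ⟫ = 0)
      (hi : ∀ g : E ≃ₗᵢ[ℝ] E, g θ = θ → MeasurePreserving g ν ν) :
      ∫ z, charFun ν (‖p‖ • z) ∂ν' = ν'.real Set.univ • charFun ν y := by
    rw [← integral_const]
    refine integral_congr_ae ?_
    filter_upwards [hs'] with z hz
    have hy : charFun ν p = charFun ν y := by
      refine integral_congr_ae ?_
      filter_upwards [hs] with x hx
      rw [hp, inner_orthogonal_part hx.2]
    obtain ⟨g, hgθ, hgp⟩ := exists_linearIsometryEquiv_fixing_map_eq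
      (p := p) (q := ‖p‖ • z) (inner_orthogonal_part_self hθ y)
      (by rw [real_inner_smul_left, hz.2, mul_zero]) (by rw [norm_smul, hz.1]; simp)
    rw [← hgp, charFun_map_linearIsometryEquiv_eq (hi g hgθ), hy]
  have hswap : ∫ z, charFun ν₁ (‖p‖ • z) ∂ν₂ = ∫ x, charFun ν₂ (‖p‖ • x) ∂ν₁ := by
    simp only [charFun_apply]
    rw [integral_integral_swap]
    · simp only [real_inner_smul_right, real_inner_comm]
    · refine Integrable.of_bound (C := 1) (Continuous.aestronglyMeasurable ?_) ?_
      · simp only [Function.uncurry_def]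
        fun_prop
      · exact Filter.Eventually.of_forall fun w => by
          simp [Function.uncurry_def, Complex.norm_exp_ofReal_mul_I]
  rw [integral_charFun hs₁ hs₂ hi₁, integral_charFun hs₂ hs₁ hi₂] at hswap
  simpa only [charFun_apply, integral_smul_measure, Measure.real] using hswap

end InvariantMeasures

lemma MeasureTheory.MeasurePreserving.withDensity_comp {α β : Type*} [MeasurableSpace α]
    [MeasurableSpace β] {μ : Measure α} {ν : Measure β} {g : α → β} (hg : MeasurePreserving g μ ν)
    {d : β → ENNReal} (hd : Measurable d) :
    MeasurePreserving g (μ.withDensity (d ∘ g)) (ν.withDensity d) := by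
  refine ⟨hg.measurable, Measure.ext fun s hs => ?_⟩
  rw [Measure.map_apply hg.measurable hs, withDensity_apply _ (hg.measurable hs),
    withDensity_apply _ hs]
  exact hg.setLIntegral_comp_preimage hs hd

section SphericalSign

variable {k : ℕ}

local notation "𝔼" => EuclideanSpace ℝ (Fin k)

lemma measurable_sSign (θ : 𝔼) : Measurable (sSign θ) := by
  refine Measurable.ite ?_ measurable_const (by fun_prop)
  exact (measurableSet_singleton θ).union (measurableSet_singleton (-θ))

lemma sSign_map {θ : 𝔼} {g : 𝔼 ≃ₗᵢ[ℝ] 𝔼} (hg : g θ = θ) (x : 𝔼) :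
    sSign θ (g x) = g (sSign θ x) := by
  have hpos : g x = θ ↔ x = θ := by rw [← g.injective.eq_iff (a := x), hg]
  have hneg : g x = -θ ↔ x = -θ := by rw [← g.injective.eq_iff (a := x), map_neg, hg]
  have hinner : ⟪g x, θ⟫ = ⟪x, θ⟫ := by rw [← g.inner_map_map x θ, hg]
  have hsub : g x - ⟪x, θ⟫ • θ = g (x - ⟪x, θ⟫ • θ) := by rw [map_sub, map_smul, hg]
  simp only [sSign, hpos, hneg, hinner, hsub, g.norm_map]
  split_ifs
  · rw [map_zero]
  · rw [map_smul]

lemma norm_sSign {θ x : 𝔼} (hθ : ‖θ‖ = 1) (hx : ‖x‖ = 1) (h : x ≠ θ) (h' : x ≠ -θ) :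
    ‖sSign θ x‖ = 1 := by
  rw [sSign, if_neg (not_or.mpr ⟨h, h'⟩), norm_smul, norm_inv, norm_norm]
  refine inv_mul_cancel₀ (norm_ne_zero_iff.mpr fun h0 => ?_)
  rw [sub_eq_zero] at h0
  have habs : |⟪x, θ⟫| = 1 := by
    rw [h0, norm_smul, hθ, mul_one, Real.norm_eq_abs] at hx
    exact hx
  rcases eq_or_eq_neg_of_abs_eq habs with h1 | h1
  · exact h (by rw [h0, h1, one_smul])
  · exact h' (by rw [h0, h1, neg_one_smul])

lemma inner_sSign {θ : 𝔼} (hθ : ‖θ‖ = 1) (x : 𝔼) : ⟪sSign θ x, θ⟫ = 0 := by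
  rw [sSign]
  split_ifs
  · exact inner_zero_left _
  · rw [real_inner_smul_left, inner_orthogonal_part_self hθ, mul_zero]

lemma measurePreserving_sphereMeasure (g : 𝔼 ≃ₗᵢ[ℝ] 𝔼) :
    MeasurePreserving g (sphereMeasure k) (sphereMeasure k) := by
  have h := (g.toIsometryEquiv.measurePreserving_hausdorffMeasure ((k : ℝ) - 1)).restrict_preimage
    (Metric.isClosed_sphere (x := (0 : 𝔼)) (ε := 1)).measurableSet
  have hpre : g.toIsometryEquiv ⁻¹' Metric.sphere (0 : 𝔼) 1 = Metric.sphere 0 1 := by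
    ext x
    simp
  rwa [hpre] at h

lemma ae_sphereMeasure (hk : 2 ≤ k) (θ : 𝔼) :
    ∀ᵐ x ∂(sphereMeasure k), ‖x‖ = 1 ∧ x ≠ θ ∧ x ≠ -θ := by
  have hd : 0 < (k : ℝ) - 1 := by
    have : (2 : ℝ) ≤ k := by exact_mod_cast hk
    linarith
  have := Measure.nullSingletonClass_hausdorff 𝔼 hd
  have : NullSingletonClass (sphereMeasure k) := by
    unfold sphereMeasure
    infer_instance
  have hsphere : ∀ᵐ x ∂(sphereMeasure k), x ∈ Metric.sphere (0 : 𝔼) 1 :=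
    ae_restrict_mem Metric.isClosed_sphere.measurableSet
  filter_upwards [hsphere, Measure.ae_ne (sphereMeasure k) θ, Measure.ae_ne (sphereMeasure k) (-θ)]
    with x hx h h'
  exact ⟨by simpa using hx, h, h'⟩

end SphericalSign

/-- under the rotationally symmetric distribution `P_{θ;f}`, the cosine
`x ↦ ⟨x,θ⟩` and the spherical sign `x ↦ S_θ(x)` are stochastically independent. -/
theorem stmt8 {k : ℕ} (hk : 2 ≤ k) (θ : EuclideanSpace ℝ (Fin k)) (hθ : ‖θ‖ = 1)
    (f : ℝ → ℝ) (hf0 : ∀ t, 0 ≤ f t) (hfm : Measurable f)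
    (hint : Integrable (fun x => f ⟪x, θ⟫) (sphereMeasure k))
    (hpos : 0 < ∫ x, f ⟪x, θ⟫ ∂(sphereMeasure k))
    (c : ℝ) (hc : c = (∫ x, f ⟪x, θ⟫ ∂(sphereMeasure k))⁻¹) :
    ProbabilityTheory.IndepFun (fun x => ⟪x, θ⟫) (fun x => sSign θ x)
      ((sphereMeasure k).withDensity fun x => ENNReal.ofReal (c * f ⟪x, θ⟫)) := by
  set d : EuclideanSpace ℝ (Fin k) → ENNReal := fun x => ENNReal.ofReal (c * f ⟪x, θ⟫) with hd
  set P := (sphereMeasure k).withDensity d with hP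
  have hdm : Measurable d := by fun_prop
  have hSm := measurable_sSign θ
  have hTm : Measurable fun x : EuclideanSpace ℝ (Fin k) => ⟪x, θ⟫ := by fun_prop
  have hP1 : P Set.univ = 1 := by
    have hc0 : 0 ≤ c := by rw [hc]; positivity
    rw [hP, withDensity_apply _ MeasurableSet.univ, Measure.restrict_univ,
      ← ofReal_integral_eq_lintegral_ofReal (hint.const_mul c)
        (Filter.Eventually.of_forall fun x => mul_nonneg hc0 (hf0 _)),
      integral_const_mul, hc, inv_mul_cancel₀ hpos.ne', ENNReal.ofReal_one]
  have : IsFiniteMeasure P := ⟨by rw [hP1]; exact ENNReal.one_lt_top⟩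
  have hPsign : ∀ᵐ x ∂P, ‖sSign θ x‖ = 1 ∧ ⟪sSign θ x, θ⟫ = 0 := by
    filter_upwards [(withDensity_absolutelyContinuous _ d).ae_le (ae_sphereMeasure hk θ)] with x hx
    exact ⟨norm_sSign hθ hx.1 hx.2.1 hx.2.2, inner_sSign hθ x⟩
  have hinner (g : EuclideanSpace ℝ (Fin k) ≃ₗᵢ[ℝ] EuclideanSpace ℝ (Fin k)) (hg : g θ = θ)
      (x : EuclideanSpace ℝ (Fin k)) : ⟪g x, θ⟫ = ⟪x, θ⟫ := by
    rw [← g.inner_map_map x θ, hg]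
  have hPinv (g : EuclideanSpace ℝ (Fin k) ≃ₗᵢ[ℝ] EuclideanSpace ℝ (Fin k)) (hg : g θ = θ) :
      MeasurePreserving g P P := by
    have hdg : d ∘ g = d := by
      funext x
      simp only [hd, Function.comp_apply, hinner g hg]
    have h := (measurePreserving_sphereMeasure g).withDensity_comp hdm
    rwa [hdg] at h
  let ν (s : Set ℝ) : Measure (EuclideanSpace ℝ (Fin k)) :=
    (P.restrict ((fun x => ⟪x, θ⟫) ⁻¹' s)).map (sSign θ)
  have hνsign (s : Set ℝ) : ∀ᵐ x ∂(ν s), ‖x‖ = 1 ∧ ⟪x, θ⟫ = 0 := by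
    rw [ae_map_iff hSm.aemeasurable]
    · exact ae_restrict_of_ae hPsign
    · exact (measurableSet_eq_fun measurable_norm measurable_const).inter
        (measurableSet_eq_fun hTm measurable_const)
  have hνinv {s : Set ℝ} (hs : MeasurableSet s)
      (g : EuclideanSpace ℝ (Fin k) ≃ₗᵢ[ℝ] EuclideanSpace ℝ (Fin k)) (hg : g θ = θ) :
      MeasurePreserving g (ν s) (ν s) := by
    have hgm : Measurable g := g.continuous.measurable
    have h := (hPinv g hg).restrict_preimage (hTm hs)
    have hpre : g ⁻¹' ((fun x => ⟪x, θ⟫) ⁻¹' s) = (fun x => ⟪x, θ⟫) ⁻¹' s := by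
      ext x
      simp only [Set.mem_preimage, hinner g hg]
    rw [hpre] at h
    have hcomp : g ∘ sSign θ = sSign θ ∘ g := funext fun x => (sSign_map hg x).symm
    refine ⟨hgm, ?_⟩
    rw [Measure.map_map hgm hSm, hcomp, ← Measure.map_map hSm hgm, h.map_eq]
  rw [ProbabilityTheory.indepFun_iff_measure_inter_preimage_eq_mul]
  intro s t hs ht
  have key := congrArg (fun m => m t) (measure_univ_smul_eq_of_invariant hθ (hνsign s)
    (hνsign Set.univ) (hνinv hs) (hνinv MeasurableSet.univ))
  simp only [ν, Measure.smul_apply, smul_eq_mul, Measure.map_apply hSm ht,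
    Measure.map_apply hSm MeasurableSet.univ, Set.preimage_univ, Measure.restrict_univ, hP1,
    one_mul, Measure.restrict_apply_univ, Measure.restrict_apply (hSm ht)] at key
  rw [Set.inter_comm]
  exact key
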